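/- Let Σ be a topological Markov shift and let r: Σ → (0,∞) be Hölder continuous and bounded away from zero and infinity. Then there exist constants C₃ > 0 and κ ∈ (0,1), depending only on r, such that for all z, w ∈ Σ_r and all τ ∈ ℝ with |τ| < 1: d_r(σ_r^τ(z), σ_r^τ(w)) ≤ C₃·d_r(z,w)^κ. -/

import Mathlib

/-- The topological Markov shift: bi-infinite paths of the directed graph with
vertex set `V` and edge relation `E`. -/
abbrev TMS (V : Type) (E : V → V → Prop) : Type :=
  {x : ℤ → V // ∀ i : ℤ, E (x i) (x (i + 1))}

/-- The `n`-th power of the left shift map (`n ∈ ℤ`); `shiftZ 1` is the left shift `σ`. -/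
def shiftZ {V : Type} {E : V → V → Prop} (n : ℤ) (x : TMS V E) : TMS V E :=
  ⟨fun i => x.1 (i + n), fun i => by
    have h := x.2 (i + n)
    have e : i + n + 1 = i + 1 + n := by ring
    rw [e] at h
    exact h⟩

open Classical in
/-- The metric `d(u,v) = exp (-min {|n| : uₙ ≠ vₙ})` on the topological Markov shift. -/
noncomputable def tmsDist {V : Type} {E : V → V → Prop} (x y : TMS V E) : ℝ :=
  if x = y then 0
  else Real.exp (-((sInf {k : ℕ | ∃ n : ℤ, n.natAbs = k ∧ x.1 n ≠ y.1 n} : ℕ) : ℝ))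

/-- Birkhoff sums `r_n` of `r`, for all `n ∈ ℤ`:
`r_n = r + r∘σ + ⋯ + r∘σ^{n-1}` for `n ≥ 1`, `r_0 = 0`, `r_n = -r_{|n|}∘σ^{-|n|}` for `n ≤ -1`. -/
noncomputable def birkhoff {V : Type} {E : V → V → Prop} (r : TMS V E → ℝ) :
    ℤ → TMS V E → ℝ
  | Int.ofNat n => fun x => ∑ k ∈ Finset.range n, r (shiftZ (k : ℤ) x)
  | Int.negSucc n => fun x => -∑ k ∈ Finset.range (n + 1), r (shiftZ ((k : ℤ) - (n + 1)) x)

/-- The phase space `Σ_r = {(x,t) : x ∈ Σ, 0 ≤ t < r(x)}` of the topological Markov flow. -/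
def SigmaR (V : Type) (E : V → V → Prop) (r : TMS V E → ℝ) : Type :=
  {p : TMS V E × ℝ // 0 ≤ p.2 ∧ p.2 < r p.1}

open Classical in
/-- The topological Markov flow `σ_r^τ (x,t) = (σ^n x, t + τ - r_n x)` for the unique
`n ∈ ℤ` with `0 ≤ t + τ - r_n x < r (σ^n x)` (junk value if no such `n` exists). -/
noncomputable def flowR {V : Type} {E : V → V → Prop} (r : TMS V E → ℝ) (τ : ℝ)
    (z : SigmaR V E r) : SigmaR V E r :=
  if h : ∃ n : ℤ, 0 ≤ z.1.2 + τ - birkhoff r n z.1.1 ∧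
      z.1.2 + τ - birkhoff r n z.1.1 < r (shiftZ n z.1.1)
  then ⟨(shiftZ h.choose z.1.1, z.1.2 + τ - birkhoff r h.choose z.1.1),
        h.choose_spec.1, h.choose_spec.2⟩
  else z

/-- The unit suspension space `Σ_1 = {(x,t) : x ∈ Σ, 0 ≤ t < 1}`. -/
def Sigma1 (V : Type) (E : V → V → Prop) : Type :=
  {p : TMS V E × ℝ // 0 ≤ p.2 ∧ p.2 < 1}

/-- The suspension flow `ψ^τ (x,t) = (σ^n x, t + τ - n)` for the unique `n ∈ ℤ` with
`0 ≤ t + τ - n < 1`, namely `n = ⌊t + τ⌋`. -/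
noncomputable def susp {V : Type} {E : V → V → Prop} (τ : ℝ) (z : Sigma1 V E) :
    Sigma1 V E :=
  ⟨(shiftZ ⌊z.1.2 + τ⌋ z.1.1, Int.fract (z.1.2 + τ)),
    Int.fract_nonneg _, Int.fract_lt_one _⟩

/-- Length of the horizontal segment `[z,w]_h` (for `z, w` of the same height `t`):
`(1-t)·d(x,y) + t·d(σx, σy)`. -/
noncomputable def hlen {V : Type} {E : V → V → Prop} (z w : Sigma1 V E) : ℝ :=
  (1 - z.1.2) * tmsDist z.1.1 w.1.1 + z.1.2 * tmsDist (shiftZ 1 z.1.1) (shiftZ 1 w.1.1)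

/-- Length of the vertical segment `[z,w]_v`: `inf {|t| : w = ψ^t z}`. -/
noncomputable def vlen {V : Type} {E : V → V → Prop} (z w : Sigma1 V E) : ℝ :=
  sInf {c : ℝ | ∃ t : ℝ, susp t z = w ∧ c = |t|}

/-- Admissible costs of a single step of a basic path from `z` to `w`: either `z, w`
form a horizontal segment (same height) of length `hlen z w`, or a vertical segment
(`w = ψ^t z` for some `t`) of length `vlen z w`. -/
def stepCost {V : Type} {E : V → V → Prop} (z w : Sigma1 V E) : Set ℝ :=
  {c | (z.1.2 = w.1.2 ∧ c = hlen z w) ∨ ((∃ t : ℝ, susp t z = w) ∧ c = vlen z w)}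

/-- The set of lengths of basic paths from `z` to `w`. -/
def pathCosts {V : Type} {E : V → V → Prop} (z w : Sigma1 V E) : Set ℝ :=
  {c | ∃ (n : ℕ) (zs : ℕ → Sigma1 V E) (cs : ℕ → ℝ),
    zs 0 = z ∧ zs n = w ∧ (∀ i < n, cs i ∈ stepCost (zs i) (zs (i + 1))) ∧
    c = ∑ i ∈ Finset.range n, cs i}

/-- The Bowen–Walters metric on `Σ_1`: infimum of lengths of basic paths. -/
noncomputable def d1 {V : Type} {E : V → V → Prop} (z w : Sigma1 V E) : ℝ :=
  sInf (pathCosts z w)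

open Classical in
/-- The canonical bijection `ϑ_r : Σ_r → Σ_1`, `ϑ_r(x,t) = (x, t/r(x))`
(junk value if `r(x) ≤ 0`). -/
noncomputable def thetaR {V : Type} {E : V → V → Prop} (r : TMS V E → ℝ)
    (z : SigmaR V E r) : Sigma1 V E :=
  if h : 0 < r z.1.1 then
    ⟨(z.1.1, z.1.2 / r z.1.1), div_nonneg z.2.1 h.le, (div_lt_one h).2 z.2.2⟩
  else ⟨(z.1.1, 0), le_refl 0, zero_lt_one⟩

/-- The Bowen–Walters distance on `Σ_r`: `d_r(z,w) = d_1(ϑ_r z, ϑ_r w)`. -/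
noncomputable def dr {V : Type} {E : V → V → Prop} (r : TMS V E → ℝ)
    (z w : SigmaR V E r) : ℝ :=
  d1 (thetaR r z) (thetaR r w)

section ShiftSpace

variable {V : Type} {E : V → V → Prop}

theorem shiftZ_zero (x : TMS V E) : shiftZ 0 x = x := by
  apply Subtype.ext; funext i; simp [shiftZ]

theorem shiftZ_shiftZ (m n : ℤ) (x : TMS V E) : shiftZ m (shiftZ n x) = shiftZ (m + n) x := by
  apply Subtype.ext; funext i; simp [shiftZ, add_assoc]

theorem tmsDist_nonneg (x y : TMS V E) : 0 ≤ tmsDist x y := by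
  unfold tmsDist; split_ifs <;> positivity

theorem tmsDist_self (x : TMS V E) : tmsDist x x = 0 := by simp [tmsDist]

theorem tmsDist_eq_exp {x y : TMS V E} (h : x ≠ y) :
    ∃ N : ℕ, tmsDist x y = Real.exp (-(N : ℝ)) ∧
      (∀ i : ℤ, i.natAbs < N → x.1 i = y.1 i) ∧ ∃ i : ℤ, i.natAbs = N ∧ x.1 i ≠ y.1 i := by
  refine ⟨sInf {k : ℕ | ∃ n : ℤ, n.natAbs = k ∧ x.1 n ≠ y.1 n}, by simp [tmsDist, h], ?_, ?_⟩
  · intro i hi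
    by_contra hne
    exact absurd (Nat.sInf_le (show i.natAbs ∈ {k : ℕ | ∃ n : ℤ, n.natAbs = k ∧ x.1 n ≠ y.1 n}
      from ⟨i, rfl, hne⟩)) (not_le.2 hi)
  · have hne : ∃ i, x.1 i ≠ y.1 i := by
      by_contra! hall
      exact h (Subtype.ext (funext hall))
    obtain ⟨i, hi⟩ := hne
    exact Nat.sInf_mem (s := {k : ℕ | ∃ n : ℤ, n.natAbs = k ∧ x.1 n ≠ y.1 n}) ⟨i.natAbs, i, rfl, hi⟩

theorem tmsDist_le_exp {x y : TMS V E} {N : ℕ} (h : ∀ i : ℤ, i.natAbs < N → x.1 i = y.1 i) :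
    tmsDist x y ≤ Real.exp (-(N : ℝ)) := by
  by_cases hxy : x = y
  · subst hxy; rw [tmsDist_self]; positivity
  · obtain ⟨M, hM, -, i, hi, hne⟩ := tmsDist_eq_exp hxy
    rw [hM]
    have : N ≤ M := by
      by_contra! hlt
      exact hne (h i (by omega))
    gcongr

theorem tmsDist_le_one (x y : TMS V E) : tmsDist x y ≤ 1 := by
  simpa using tmsDist_le_exp (x := x) (y := y) (N := 0) (by simp)

theorem tmsDist_triangle (x y z : TMS V E) : tmsDist x z ≤ tmsDist x y + tmsDist y z := by
  by_cases hxy : x = y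
  · subst hxy; simp [tmsDist_self]
  by_cases hyz : y = z
  · subst hyz; simp [tmsDist_self]
  obtain ⟨M, hM, hM', -⟩ := tmsDist_eq_exp hxy
  obtain ⟨N, hN, hN', -⟩ := tmsDist_eq_exp hyz
  have h : tmsDist x z ≤ Real.exp (-((min M N : ℕ) : ℝ)) :=
    tmsDist_le_exp fun i hi => (hM' i (by omega)).trans (hN' i (by omega))
  have hp := Real.exp_pos (-(M : ℝ))
  have hq := Real.exp_pos (-(N : ℝ))
  rw [hM, hN]
  rcases min_choice M N with e | e <;> rw [e] at h <;> linarith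

theorem tmsDist_shiftZ_le (n : ℤ) {N : ℕ} (hn : n.natAbs ≤ N) (x y : TMS V E) :
    tmsDist (shiftZ n x) (shiftZ n y) ≤ Real.exp N * tmsDist x y := by
  by_cases hxy : x = y
  · subst hxy; simp [tmsDist_self]
  obtain ⟨M, hM, hM', -⟩ := tmsDist_eq_exp hxy
  have h : tmsDist (shiftZ n x) (shiftZ n y) ≤ Real.exp (-((M - N : ℕ) : ℝ)) :=
    tmsDist_le_exp fun i hi => hM' (i + n) (by omega)
  rw [hM, ← Real.exp_add]
  refine h.trans (Real.exp_le_exp.2 ?_)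
  have : M ≤ (M - N) + N := by omega
  have : (M : ℝ) ≤ (M - N : ℕ) + N := by exact_mod_cast this
  linarith

theorem tmsDist_le_shiftZ (n : ℤ) {N : ℕ} (hn : n.natAbs ≤ N) (x y : TMS V E) :
    tmsDist x y ≤ Real.exp N * tmsDist (shiftZ n x) (shiftZ n y) := by
  have h := tmsDist_shiftZ_le (-n) (by simpa using hn) (shiftZ n x) (shiftZ n y)
  simpa [shiftZ_shiftZ, shiftZ_zero] using h

end ShiftSpace

section Suspension

variable {V : Type} {E : V → V → Prop}

/-- The point of `Σ_1` with lifted coordinates `(x, S)`, for arbitrary real height `S`. -/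
noncomputable def liftPt (x : TMS V E) (S : ℝ) : Sigma1 V E :=
  ⟨(shiftZ ⌊S⌋ x, Int.fract S), Int.fract_nonneg _, Int.fract_lt_one _⟩

theorem liftPt_self (z : Sigma1 V E) : liftPt z.1.1 z.1.2 = z := by
  obtain ⟨⟨x, t⟩, ht⟩ := z
  have hf : ⌊t⌋ = 0 := Int.floor_eq_zero_iff.2 ht
  apply Subtype.ext
  simp [liftPt, hf, shiftZ_zero, Int.fract_eq_self.2 ht]

theorem susp_liftPt (τ : ℝ) (x : TMS V E) (S : ℝ) :
    susp τ (liftPt x S) = liftPt x (S + τ) := by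
  have e : Int.fract S + τ = (S + τ) - (⌊S⌋ : ℤ) := by rw [Int.fract]; ring
  apply Subtype.ext
  simp only [susp, liftPt, shiftZ_shiftZ]
  rw [e, Int.fract_sub_intCast, Int.floor_sub_intCast]
  simp

theorem liftPt_shiftZ (n : ℤ) (x : TMS V E) (S : ℝ) :
    liftPt (shiftZ n x) S = liftPt x (S + n) := by
  apply Subtype.ext
  simp [liftPt, shiftZ_shiftZ]

theorem eq_liftPt_of_height_eq {X : TMS V E} {T : ℝ} {w : Sigma1 V E}
    (h : (liftPt X T).1.2 = w.1.2) : w = liftPt (shiftZ (-⌊T⌋) w.1.1) T := by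
  apply Subtype.ext
  apply Prod.ext
  · simp [liftPt, shiftZ_shiftZ, shiftZ_zero]
  · exact h.symm

theorem hlen_nonneg (z w : Sigma1 V E) : 0 ≤ hlen z w := by
  have h1 := tmsDist_nonneg z.1.1 w.1.1
  have h2 := tmsDist_nonneg (shiftZ 1 z.1.1) (shiftZ 1 w.1.1)
  have h3 : 0 ≤ 1 - z.1.2 := by linarith [z.2.2]
  exact add_nonneg (mul_nonneg h3 h1) (mul_nonneg z.2.1 h2)

theorem hlen_le (z w : Sigma1 V E) : hlen z w ≤ Real.exp 1 * tmsDist z.1.1 w.1.1 := by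
  have h1 := tmsDist_nonneg z.1.1 w.1.1
  have h2 := tmsDist_shiftZ_le 1 (N := 1) (by simp) z.1.1 w.1.1
  rw [Nat.cast_one] at h2
  have he : 1 ≤ Real.exp 1 := Real.one_le_exp zero_le_one
  have h3 : 0 ≤ 1 - z.1.2 := by linarith [z.2.2]
  have h4 : tmsDist z.1.1 w.1.1 ≤ Real.exp 1 * tmsDist z.1.1 w.1.1 := le_mul_of_one_le_left h1 he
  have h5 := mul_le_mul_of_nonneg_left h4 h3
  have h6 := mul_le_mul_of_nonneg_left h2 z.2.1
  unfold hlen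
  linarith

theorem tmsDist_le_hlen (z w : Sigma1 V E) : tmsDist z.1.1 w.1.1 ≤ Real.exp 1 * hlen z w := by
  have h1 := tmsDist_nonneg z.1.1 w.1.1
  have h2 := tmsDist_le_shiftZ 1 (N := 1) (by simp) z.1.1 w.1.1
  rw [Nat.cast_one] at h2
  have he : 1 ≤ Real.exp 1 := Real.one_le_exp zero_le_one
  have h3 : 0 ≤ 1 - z.1.2 := by linarith [z.2.2]
  have h4 : tmsDist z.1.1 w.1.1 ≤ Real.exp 1 * tmsDist z.1.1 w.1.1 := le_mul_of_one_le_left h1 he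
  have h5 := mul_le_mul_of_nonneg_left h4 h3
  have h6 := mul_le_mul_of_nonneg_left h2 z.2.1
  unfold hlen
  linarith

theorem vlen_nonneg (z w : Sigma1 V E) : 0 ≤ vlen z w := by
  apply Real.sInf_nonneg
  rintro c ⟨t, -, rfl⟩
  exact abs_nonneg t

theorem vlen_susp_le (t : ℝ) (z : Sigma1 V E) : vlen z (susp t z) ≤ |t| := by
  refine csInf_le ⟨0, ?_⟩ ⟨t, rfl, rfl⟩
  rintro c ⟨t, -, rfl⟩
  exact abs_nonneg t

theorem stepCost_nonneg {z w : Sigma1 V E} {c : ℝ} (h : c ∈ stepCost z w) : 0 ≤ c := by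
  rcases h with ⟨-, rfl⟩ | ⟨-, rfl⟩
  · exact hlen_nonneg z w
  · exact vlen_nonneg z w

theorem pathCosts_nonneg {z w : Sigma1 V E} {c : ℝ} (h : c ∈ pathCosts z w) : 0 ≤ c := by
  obtain ⟨n, zs, cs, -, -, hc, rfl⟩ := h
  exact Finset.sum_nonneg fun i hi => stepCost_nonneg (hc i (Finset.mem_range.1 hi))

theorem add_mem_pathCosts {z u w : Sigma1 V E} {c c' : ℝ} (h : c ∈ stepCost z u)
    (h' : c' ∈ stepCost u w) : c + c' ∈ pathCosts z w := by
  refine ⟨2, fun i => if i = 0 then z else if i = 1 then u else w,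
    fun i => if i = 0 then c else c', by simp, by simp, ?_, by simp [Finset.sum_range_succ]⟩
  intro i hi
  interval_cases i
  · simpa using h
  · simpa using h'

theorem liftPt_pathCosts (x y : TMS V E) (S T : ℝ) :
    hlen (liftPt x S) (liftPt y S) + vlen (liftPt y S) (liftPt y T) ∈
      pathCosts (liftPt x S) (liftPt y T) := by
  refine add_mem_pathCosts (u := liftPt y S) (Or.inl ⟨rfl, rfl⟩) (Or.inr ⟨⟨T - S, ?_⟩, rfl⟩)
  rw [susp_liftPt, add_sub_cancel]

theorem pathCosts_nonempty (z w : Sigma1 V E) : (pathCosts z w).Nonempty := by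
  rw [← liftPt_self z, ← liftPt_self w]
  exact ⟨_, liftPt_pathCosts _ _ _ _⟩

theorem d1_nonneg (z w : Sigma1 V E) : 0 ≤ d1 z w :=
  Real.sInf_nonneg fun _ h => pathCosts_nonneg h

theorem d1_liftPt_le (x y : TMS V E) (S T : ℝ) {N : ℕ} (hN : ⌊S⌋.natAbs ≤ N) :
    d1 (liftPt x S) (liftPt y T) ≤ Real.exp 1 * (Real.exp N * tmsDist x y) + |T - S| := by
  refine (csInf_le ⟨0, fun _ h => pathCosts_nonneg h⟩ (liftPt_pathCosts x y S T)).trans ?_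
  have hv : vlen (liftPt y S) (liftPt y T) ≤ |T - S| := by
    have h := vlen_susp_le (T - S) (liftPt y S)
    rwa [susp_liftPt, add_sub_cancel] at h
  refine add_le_add ((hlen_le _ _).trans ?_) hv
  gcongr
  exact tmsDist_shiftZ_le _ hN x y

theorem d1_le_const (z w : Sigma1 V E) : d1 z w ≤ Real.exp 1 + 1 := by
  have hf : ⌊z.1.2⌋ = 0 := Int.floor_eq_zero_iff.2 z.2
  have h := d1_liftPt_le z.1.1 w.1.1 z.1.2 w.1.2 (N := 0) (by simp [hf])
  rw [liftPt_self, liftPt_self] at h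
  refine h.trans (add_le_add ?_ ?_)
  · simpa using mul_le_of_le_one_right (Real.exp_pos 1).le (tmsDist_le_one z.1.1 w.1.1)
  · rw [abs_le]
    constructor <;> linarith [z.2.1, z.2.2, w.2.1, w.2.2]

/-- A basic path of length less than one lifts: its endpoint has lifted coordinates close to
those of its starting point. -/
theorem exists_lift_of_path (z : Sigma1 V E) (n : ℕ) (zs : ℕ → Sigma1 V E) (cs : ℕ → ℝ)
    (h0 : zs 0 = z) (hstep : ∀ i < n, cs i ∈ stepCost (zs i) (zs (i + 1))) :
    ∀ η : ℝ, 0 < η → ∑ i ∈ Finset.range n, cs i + η ≤ 1 →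
      ∃ (X : TMS V E) (T : ℝ), zs n = liftPt X T ∧
        |T - z.1.2| + Real.exp (-3) * tmsDist z.1.1 X ≤ ∑ i ∈ Finset.range n, cs i + η := by
  induction n with
  | zero =>
    intro η hη _
    exact ⟨z.1.1, z.1.2, by rw [h0, liftPt_self], by simpa [tmsDist_self] using hη.le⟩
  | succ n ih =>
    intro η hη hsum
    rw [Finset.sum_range_succ] at hsum ⊢
    have hc := hstep n n.lt_succ_self
    have hc0 := stepCost_nonneg hc
    obtain ⟨X, T, hX, hbd⟩ := ih (fun i hi => hstep i (hi.trans n.lt_succ_self)) (η / 2)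
      (by linarith) (by linarith)
    rw [hX] at hc
    have hd := tmsDist_nonneg z.1.1 X
    rcases hc with ⟨hh, hc⟩ | ⟨⟨t, ht⟩, hc⟩
    · refine ⟨_, T, eq_liftPt_of_height_eq hh, ?_⟩
      have hT : |T - z.1.2| ≤ 1 := by
        have : 0 ≤ Real.exp (-3) * tmsDist z.1.1 X := by positivity
        linarith
      have hfl : ⌊T⌋.natAbs ≤ 2 := by
        rw [abs_le] at hT
        have h1 : (-2 : ℤ) ≤ ⌊T⌋ := Int.le_floor.2 (by push_cast; linarith [z.2.1])
        have h2 : ⌊T⌋ < 3 := Int.floor_lt.2 (by push_cast; linarith [z.2.2])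
        omega
      set w := zs (n + 1)
      have e1 := tmsDist_le_shiftZ ⌊T⌋ hfl X (shiftZ (-⌊T⌋) w.1.1)
      rw [shiftZ_shiftZ, add_neg_cancel, shiftZ_zero] at e1
      have e2 : tmsDist (shiftZ ⌊T⌋ X) w.1.1 ≤ Real.exp 1 * cs n := by
        rw [hc]; exact tmsDist_le_hlen (liftPt X T) w
      have e3 : Real.exp (-3) * tmsDist X (shiftZ (-⌊T⌋) w.1.1) ≤ cs n := by
        calc Real.exp (-3) * tmsDist X (shiftZ (-⌊T⌋) w.1.1)
            ≤ Real.exp (-3) * (Real.exp (2 : ℕ) * (Real.exp 1 * cs n)) := by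
              gcongr; exact e1.trans (by gcongr)
          _ = cs n := by
              rw [← mul_assoc, ← mul_assoc, ← Real.exp_add, ← Real.exp_add]
              norm_num
      have e4 := mul_le_mul_of_nonneg_left
        (tmsDist_triangle z.1.1 X (shiftZ (-⌊T⌋) w.1.1)) (Real.exp_pos (-3)).le
      linarith
    · obtain ⟨c, ⟨t', ht', rfl⟩, hlt⟩ := exists_lt_of_csInf_lt
        (s := {c : ℝ | ∃ t : ℝ, susp t (liftPt X T) = zs (n + 1) ∧ c = |t|}) ⟨|t|, t, ht, rfl⟩
        (show vlen (liftPt X T) (zs (n + 1)) < cs n + η / 2 by linarith)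
      refine ⟨X, T + t', by rw [← susp_liftPt, ht'], ?_⟩
      have : |T + t' - z.1.2| ≤ |T - z.1.2| + |t'| := by
        rw [add_sub_right_comm]; exact abs_add_le _ _
      linarith

theorem exists_lift_of_d1_lt {z w : Sigma1 V E} {ε : ℝ} (hε : ε ≤ 1) (h : d1 z w < ε) :
    ∃ (X : TMS V E) (T : ℝ), w = liftPt X T ∧ |T - z.1.2| ≤ ε ∧
      tmsDist z.1.1 X ≤ Real.exp 3 * ε := by
  obtain ⟨c, ⟨n, zs, cs, h0, hn, hstep, rfl⟩, hlt⟩ :=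
    exists_lt_of_csInf_lt (pathCosts_nonempty z w) h
  obtain ⟨X, T, hX, hb⟩ := exists_lift_of_path z n zs cs h0 hstep
    (ε - ∑ i ∈ Finset.range n, cs i) (by linarith) (by linarith)
  rw [add_sub_cancel] at hb
  have hd := mul_nonneg (Real.exp_pos (-3)).le (tmsDist_nonneg z.1.1 X)
  refine ⟨X, T, hn ▸ hX, by linarith, ?_⟩
  have h1 : Real.exp (-3) * tmsDist z.1.1 X ≤ ε := by linarith [abs_nonneg (T - z.1.2)]
  rw [Real.exp_neg] at h1
  exact (inv_mul_le_iff₀ (Real.exp_pos 3)).1 h1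

end Suspension

section RoofFunction

variable {V : Type} {E : V → V → Prop}

theorem birkhoff_zero (r : TMS V E → ℝ) (x : TMS V E) : birkhoff r 0 x = 0 := by
  change birkhoff r (Int.ofNat 0) x = 0
  simp [birkhoff]

theorem birkhoff_add_one (r : TMS V E → ℝ) (n : ℤ) (x : TMS V E) :
    birkhoff r (n + 1) x = birkhoff r n x + r (shiftZ n x) := by
  rcases n with n | n
  · change birkhoff r (Int.ofNat (n + 1)) x = _
    simp [birkhoff, Finset.sum_range_succ]
  · rcases n with _ | n
    · change birkhoff r (Int.ofNat 0) x = _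
      simp [birkhoff]
    · have e : Int.negSucc (n + 1) + 1 = Int.negSucc n := by omega
      rw [e]
      simp only [birkhoff]
      rw [Finset.sum_range_succ' _ (n + 1)]
      have e1 : ∀ k : ℕ, ((k + 1 : ℕ) : ℤ) - (((n + 1 : ℕ) : ℤ) + 1) = (k : ℤ) - ((n : ℤ) + 1) := by
        intro k; push_cast; ring
      have e2 : ((0 : ℕ) : ℤ) - (((n + 1 : ℕ) : ℤ) + 1) = Int.negSucc (n + 1) := by omega
      simp only [e1, e2]
      ring

theorem birkhoff_add (r : TMS V E → ℝ) (m n : ℤ) (x : TMS V E) :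
    birkhoff r (m + n) x = birkhoff r n x + birkhoff r m (shiftZ n x) := by
  have step : ∀ m : ℤ, birkhoff r (m + 1 + n) x = birkhoff r (m + n) x + r (shiftZ (m + n) x) := by
    intro m
    rw [add_right_comm, birkhoff_add_one]
  have step' : ∀ m : ℤ, birkhoff r (m + 1) (shiftZ n x)
      = birkhoff r m (shiftZ n x) + r (shiftZ (m + n) x) := by
    intro m
    rw [birkhoff_add_one, shiftZ_shiftZ]
  induction m using Int.induction_on with
  | zero => simp [birkhoff_zero]
  | succ i ih => rw [step, step', ih]; ring
  | pred i ih =>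
    have h1 := step (-(i : ℤ) - 1)
    have h2 := step' (-(i : ℤ) - 1)
    rw [sub_add_cancel] at h1 h2
    linarith

theorem birkhoff_sub_bounds {r : TMS V E → ℝ} {a b : ℝ} (hab : ∀ x, a ≤ r x ∧ r x ≤ b)
    (x : TMS V E) {m n : ℤ} (h : m ≤ n) :
    a * (n - m) ≤ birkhoff r n x - birkhoff r m x ∧
      birkhoff r n x - birkhoff r m x ≤ b * (n - m) := by
  induction n, h using Int.leInduction with
  | base => simp
  | succ n _ ih =>
    rw [birkhoff_add_one]
    push_cast
    have := hab (shiftZ n x)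
    constructor <;> linarith [ih.1, ih.2]

theorem exists_birkhoff_index {r : TMS V E → ℝ} {a b : ℝ} (ha : 0 < a)
    (hab : ∀ x, a ≤ r x ∧ r x ≤ b) (x : TMS V E) (T : ℝ) :
    ∃ n : ℤ, 0 ≤ T - birkhoff r n x ∧ T - birkhoff r n x < r (shiftZ n x) := by
  have hex : ∃ n : ℤ, birkhoff r n x ≤ T := by
    refine ⟨-(⌈|T| / a⌉), ?_⟩
    have hle : -(⌈|T| / a⌉) ≤ 0 := by
      have : 0 ≤ ⌈|T| / a⌉ := Int.ceil_nonneg (by positivity)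
      omega
    have h1 := (birkhoff_sub_bounds hab x hle).1
    rw [birkhoff_zero] at h1
    have h2 := (div_le_iff₀ ha).1 (Int.le_ceil (|T| / a))
    push_cast at h1
    linarith [neg_abs_le T]
  have hbd : ∃ M : ℤ, ∀ n : ℤ, birkhoff r n x ≤ T → n ≤ M := by
    refine ⟨⌈|T| / a⌉, fun n hn => ?_⟩
    by_contra! hlt
    have h0 : 0 ≤ ⌈|T| / a⌉ := Int.ceil_nonneg (by positivity)
    have h1 := (birkhoff_sub_bounds hab x (h0.trans hlt.le)).1
    rw [birkhoff_zero] at h1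
    have h2 := (div_le_iff₀ ha).1 (Int.le_ceil (|T| / a))
    have h3 : (⌈|T| / a⌉ : ℝ) < n := by exact_mod_cast hlt
    have h4 := mul_lt_mul_of_pos_left h3 ha
    push_cast at h1
    linarith [le_abs_self T]
  obtain ⟨n, hn, hmax⟩ := Int.exists_greatest_of_bdd hbd hex
  refine ⟨n, by linarith, ?_⟩
  by_contra! hge
  have := hmax (n + 1) (by rw [birkhoff_add_one]; linarith)
  omega

/-- The time at which the `r`-flow started at `(x, 0)` reaches lifted unit height `S`. -/
noncomputable def hitTime (r : TMS V E → ℝ) (x : TMS V E) (S : ℝ) : ℝ :=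
  birkhoff r ⌊S⌋ x + Int.fract S * r (shiftZ ⌊S⌋ x)

theorem hitTime_shiftZ (r : TMS V E → ℝ) (n : ℤ) (x : TMS V E) (S : ℝ) :
    hitTime r x (S + n) = birkhoff r n x + hitTime r (shiftZ n x) S := by
  simp only [hitTime, Int.floor_add_intCast, Int.fract_add_intCast, birkhoff_add, shiftZ_shiftZ]
  ring

theorem hitTime_of_mem_Ico (r : TMS V E → ℝ) (n : ℤ) (x : TMS V E) {s : ℝ} (h0 : 0 ≤ s)
    (h1 : s < 1) : hitTime r x (s + n) = birkhoff r n x + s * r (shiftZ n x) := by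
  have hf : ⌊s⌋ = 0 := Int.floor_eq_zero_iff.2 ⟨h0, h1⟩
  rw [hitTime_shiftZ, hitTime, hf, Int.fract_eq_self.2 ⟨h0, h1⟩, birkhoff_zero, shiftZ_zero,
    zero_add]

theorem hitTime_sub_bounds {r : TMS V E → ℝ} {a b : ℝ} (hab : ∀ x, a ≤ r x ∧ r x ≤ b)
    (x : TMS V E) {S T : ℝ} (h : S ≤ T) :
    a * (T - S) ≤ hitTime r x T - hitTime r x S ∧
      hitTime r x T - hitTime r x S ≤ b * (T - S) := by
  have hS := Int.floor_add_fract S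
  have hT := Int.floor_add_fract T
  have hS0 := Int.fract_nonneg S
  have hS1 := (Int.fract_lt_one S).le
  have hT0 := Int.fract_nonneg T
  have hrS := hab (shiftZ ⌊S⌋ x)
  have hrT := hab (shiftZ ⌊T⌋ x)
  unfold hitTime
  rcases (Int.floor_le_floor h).eq_or_lt with e | hlt
  · rw [← e] at hT hrT ⊢
    have hd : 0 ≤ Int.fract T - Int.fract S := by linarith
    have e' : T - S = Int.fract T - Int.fract S := by linarith
    rw [e']
    constructor <;> nlinarith [mul_le_mul_of_nonneg_left hrS.1 hd,
      mul_le_mul_of_nonneg_left hrS.2 hd]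
  · have hB := birkhoff_sub_bounds hab x (Int.add_one_le_iff.2 hlt)
    rw [birkhoff_add_one] at hB
    push_cast at hB
    have hd : 0 ≤ 1 - Int.fract S := by linarith
    have e' : T - S = (⌊T⌋ - (⌊S⌋ + 1)) + (1 - Int.fract S) + Int.fract T := by linarith
    rw [e']
    constructor <;> nlinarith [mul_le_mul_of_nonneg_left hrS.1 hd,
      mul_le_mul_of_nonneg_left hrS.2 hd, mul_le_mul_of_nonneg_left hrT.1 hT0,
      mul_le_mul_of_nonneg_left hrT.2 hT0, hB.1, hB.2]

theorem hitTime_abs_bounds {r : TMS V E → ℝ} {a b : ℝ} (hab : ∀ x, a ≤ r x ∧ r x ≤ b)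
    (ha : 0 < a) (x : TMS V E) (S T : ℝ) :
    a * |T - S| ≤ |hitTime r x T - hitTime r x S| ∧
      |hitTime r x T - hitTime r x S| ≤ b * |T - S| := by
  wlog h : S ≤ T generalizing S T
  · rw [abs_sub_comm T, abs_sub_comm (hitTime r x T)]
    exact this T S (le_of_not_ge h)
  have hb := hitTime_sub_bounds hab x h
  have h1 : 0 ≤ T - S := by linarith
  have h2 : 0 ≤ hitTime r x T - hitTime r x S := (mul_nonneg ha.le h1).trans hb.1
  rwa [abs_of_nonneg h1, abs_of_nonneg h2]

theorem abs_roof_shiftZ_sub_le {r : TMS V E → ℝ} {H α : ℝ} (hH : 0 < H) (hα : 0 < α)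
    (hHol : ∀ x y : TMS V E, |r x - r y| ≤ H * tmsDist x y ^ α) (x y : TMS V E) {n : ℤ} {N : ℕ}
    (hn : n.natAbs ≤ N) :
    |r (shiftZ n x) - r (shiftZ n y)| ≤ H * (Real.exp N * tmsDist x y) ^ α := by
  refine (hHol _ _).trans ?_
  have := tmsDist_nonneg (shiftZ n x) (shiftZ n y)
  gcongr
  exact tmsDist_shiftZ_le n hn x y

theorem abs_birkhoff_sub_le {r : TMS V E → ℝ} {H α : ℝ} (hH : 0 < H) (hα : 0 < α)
    (hHol : ∀ x y : TMS V E, |r x - r y| ≤ H * tmsDist x y ^ α) (x y : TMS V E) {n : ℤ} {N : ℕ}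
    (hn : n.natAbs ≤ N) :
    |birkhoff r n x - birkhoff r n y| ≤ N * (H * (Real.exp N * tmsDist x y) ^ α) := by
  have key : ∀ k ≤ N, |birkhoff r k x - birkhoff r k y| ≤
      k * (H * (Real.exp N * tmsDist x y) ^ α) ∧
      |birkhoff r (-k) x - birkhoff r (-k) y| ≤ k * (H * (Real.exp N * tmsDist x y) ^ α) := by
    intro k
    induction k with
    | zero => simp [birkhoff_zero]
    | succ k ih =>
      intro hk
      obtain ⟨h1, h2⟩ := ih (by omega)
      have r1 := abs_roof_shiftZ_sub_le hH hα hHol x y (n := (k : ℤ)) (N := N) (by omega)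
      have r2 := abs_roof_shiftZ_sub_le hH hα hHol x y (n := -((k : ℤ) + 1)) (N := N) (by omega)
      have b1 := fun u : TMS V E => birkhoff_add_one r (k : ℤ) u
      have b2 := fun u : TMS V E => birkhoff_add_one r (-((k : ℤ) + 1)) u
      have e : -((k : ℤ) + 1) + 1 = -k := by ring
      simp only [e] at b2
      push_cast
      simp only [abs_le] at h1 h2 r1 r2 ⊢
      refine ⟨⟨?_, ?_⟩, ?_, ?_⟩ <;> linarith [b1 x, b1 y, b2 x, b2 y]
  have hd := tmsDist_nonneg x y
  have hmono : (n.natAbs : ℝ) * (H * (Real.exp N * tmsDist x y) ^ α) ≤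
      N * (H * (Real.exp N * tmsDist x y) ^ α) := by
    gcongr
  refine le_trans ?_ hmono
  rcases Int.natAbs_eq n with e | e
  · have := (key _ hn).1
    rwa [← e] at this
  · have := (key _ hn).2
    rwa [← e] at this

theorem abs_hitTime_sub_le {r : TMS V E → ℝ} {H α : ℝ} (hH : 0 < H) (hα : 0 < α)
    (hHol : ∀ x y : TMS V E, |r x - r y| ≤ H * tmsDist x y ^ α) (x y : TMS V E) {S : ℝ} {N : ℕ}
    (hn : ⌊S⌋.natAbs ≤ N) :
    |hitTime r x S - hitTime r y S| ≤ (N + 1) * (H * (Real.exp N * tmsDist x y) ^ α) := by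
  have h1 := abs_birkhoff_sub_le hH hα hHol x y hn
  have h2 := abs_roof_shiftZ_sub_le hH hα hHol x y hn
  have h3 := abs_add_le (birkhoff r ⌊S⌋ x - birkhoff r ⌊S⌋ y)
    (Int.fract S * (r (shiftZ ⌊S⌋ x) - r (shiftZ ⌊S⌋ y)))
  rw [abs_mul, abs_of_nonneg (Int.fract_nonneg S)] at h3
  have h4 := mul_le_of_le_one_left (abs_nonneg (r (shiftZ ⌊S⌋ x) - r (shiftZ ⌊S⌋ y)))
    (Int.fract_lt_one S).le
  have e : hitTime r x S - hitTime r y S = birkhoff r ⌊S⌋ x - birkhoff r ⌊S⌋ y +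
      Int.fract S * (r (shiftZ ⌊S⌋ x) - r (shiftZ ⌊S⌋ y)) := by
    unfold hitTime; ring
  rw [e]
  linarith

/-- In lifted coordinates, the flow `σ_r^τ` advances `hitTime` by `τ`. -/
theorem exists_thetaR_flowR {r : TMS V E → ℝ} {a b : ℝ} (ha : 0 < a)
    (hab : ∀ x, a ≤ r x ∧ r x ≤ b) (τ : ℝ) (z : SigmaR V E r) (X : TMS V E) (T : ℝ)
    (hz : thetaR r z = liftPt X T) :
    ∃ S : ℝ, thetaR r (flowR r τ z) = liftPt X S ∧ hitTime r X S = hitTime r X T + τ := by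
  obtain ⟨⟨x, t⟩, ht0, ht1⟩ := z
  have hpos : ∀ u, 0 < r u := fun u => ha.trans_le (hab u).1
  have h := exists_birkhoff_index ha hab x (t + τ)
  set n := h.choose with hn
  have hspec := h.choose_spec
  rw [← hn] at hspec
  set s := (t + τ - birkhoff r n x) / r (shiftZ n x) with hs
  have hs0 : 0 ≤ s := div_nonneg hspec.1 (hpos _).le
  have hs1 : s < 1 := (div_lt_one (hpos _)).2 hspec.2
  have hflow : thetaR r (flowR r τ ⟨(x, t), ht0, ht1⟩) = liftPt x (s + n) := by
    have e : flowR r τ ⟨(x, t), ht0, ht1⟩ =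
        ⟨(shiftZ n x, t + τ - birkhoff r n x), hspec.1, hspec.2⟩ := dif_pos h
    rw [e, ← liftPt_shiftZ]
    exact (dif_pos (hpos _)).trans (liftPt_self ⟨(shiftZ n x, s), hs0, hs1⟩).symm
  have hx : x = shiftZ ⌊T⌋ X := by
    have := congrArg (fun q => q.1.1) hz
    simpa [thetaR, hpos, liftPt] using this
  have ht : t / r x = Int.fract T := by
    have := congrArg (fun q => q.1.2) hz
    simpa [thetaR, hpos, liftPt] using this
  refine ⟨s + n + ⌊T⌋, by rw [hflow, hx, liftPt_shiftZ], ?_⟩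
  rw [hitTime_shiftZ, ← hx, hitTime_of_mem_Ico r n x hs0 hs1, hs, div_mul_cancel₀ _ (hpos _).ne',
    hitTime, ← hx, ← ht, div_mul_cancel₀ _ (hpos x).ne']
  ring

end RoofFunction

section HolderFlow

variable {V : Type} {E : V → V → Prop}

/-- Stability of the flow in lifted coordinates: nearby lifted points stay Hölder-close. -/
theorem d1_liftPt_le_of_hitTime {r : TMS V E → ℝ} {a b H α : ℝ} (ha : 0 < a)
    (hab : ∀ x, a ≤ r x ∧ r x ≤ b) (hH : 0 < H) (hα : 0 < α)
    (hHol : ∀ x y : TMS V E, |r x - r y| ≤ H * tmsDist x y ^ α) {x y : TMS V E}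
    {t s t' s' τ : ℝ} {N : ℕ} (ht : ⌊t⌋.natAbs ≤ N) (ht' : ⌊t'⌋.natAbs ≤ N)
    (hx : hitTime r x t' = hitTime r x t + τ) (hy : hitTime r y s' = hitTime r y s + τ) :
    d1 (liftPt x t') (liftPt y s') ≤ Real.exp 1 * (Real.exp N * tmsDist x y) +
      (2 * ((N + 1) * (H * (Real.exp N * tmsDist x y) ^ α)) + b * |s - t|) / a := by
  refine (d1_liftPt_le x y t' s' ht').trans ?_
  gcongr
  rw [le_div_iff₀ ha, mul_comm]
  have h1 := (hitTime_abs_bounds hab ha y t' s').1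
  have h2 := (hitTime_abs_bounds hab ha y t s).2
  have h3 := abs_hitTime_sub_le hH hα hHol x y ht
  have h4 := abs_hitTime_sub_le hH hα hHol x y ht'
  refine h1.trans ?_
  rw [abs_le] at *
  constructor <;> linarith [h2.1, h2.2, h3.1, h3.2, h4.1, h4.2]

theorem exists_holder_bound_of_dr_lt {r : TMS V E → ℝ} {a b H α : ℝ} (ha : 0 < a)
    (hb : 0 < b) (hab : ∀ x, a ≤ r x ∧ r x ≤ b) (hH : 0 < H) (hα : 0 < α) (hα1 : α ≤ 1)
    (hHol : ∀ x y : TMS V E, |r x - r y| ≤ H * tmsDist x y ^ α) :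
    ∃ C : ℝ, 0 ≤ C ∧ ∀ (z w : SigmaR V E r) (τ ε : ℝ), |τ| < 1 → 0 < ε → ε ≤ 1 →
      dr r z w < ε → dr r (flowR r τ z) (flowR r τ w) ≤ C * ε ^ α := by
  set N : ℕ := ⌈1 / a⌉₊ + 1 with hN
  refine ⟨Real.exp 1 * (Real.exp N * Real.exp 3) +
    (2 * ((N + 1) * (H * (Real.exp N * Real.exp 3) ^ α)) + b) / a, by positivity, ?_⟩
  intro z w τ ε hτ hε hε1 hlt
  obtain ⟨Y, S, hw, hS, hY⟩ := exists_lift_of_d1_lt hε1 hlt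
  obtain ⟨t', hzt, ht'⟩ := exists_thetaR_flowR ha hab τ z _ _ (liftPt_self (thetaR r z)).symm
  obtain ⟨s', hws, hs'⟩ := exists_thetaR_flowR ha hab τ w Y S hw
  set x := (thetaR r z).1.1
  set t := (thetaR r z).1.2
  have ht0 : 0 ≤ t := (thetaR r z).2.1
  have ht1 : t < 1 := (thetaR r z).2.2
  have hft : ⌊t⌋ = 0 := Int.floor_eq_zero_iff.2 ⟨ht0, ht1⟩
  have hdiff : |t' - t| ≤ 1 / a := by
    rw [le_div_iff₀ ha, mul_comm]
    refine ((hitTime_abs_bounds hab ha x t t').1).trans ?_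
    rw [ht', add_sub_cancel_left]
    exact hτ.le
  have hNa : 1 / a ≤ (N : ℝ) - 1 := by
    rw [hN]; push_cast
    linarith [Nat.le_ceil (1 / a)]
  have hft' : ⌊t'⌋.natAbs ≤ N := by
    rw [abs_le] at hdiff
    have h1 : -(N : ℤ) ≤ ⌊t'⌋ := Int.le_floor.2 (by push_cast; linarith)
    have h2 : ⌊t'⌋ ≤ (N : ℤ) := by
      have : (⌊t'⌋ : ℝ) ≤ N := (Int.floor_le t').trans (by linarith)
      exact_mod_cast this
    omega
  have hmain := d1_liftPt_le_of_hitTime ha hab hH hα hHol (by simp [hft]) hft' ht' hs'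
  rw [dr, hzt, hws]
  refine hmain.trans ?_
  have hd := tmsDist_nonneg x Y
  have hEd : Real.exp N * tmsDist x Y ≤ Real.exp N * Real.exp 3 * ε := by
    rw [mul_assoc]; gcongr
  have hpow : (Real.exp N * tmsDist x Y) ^ α ≤ (Real.exp N * Real.exp 3) ^ α * ε ^ α := by
    rw [← Real.mul_rpow (by positivity) hε.le]
    gcongr
  have hεα : ε ≤ ε ^ α := by
    simpa using Real.rpow_le_rpow_of_exponent_ge hε hε1 hα1
  have hEd' : Real.exp N * tmsDist x Y ≤ Real.exp N * Real.exp 3 * ε ^ α :=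
    hEd.trans (by gcongr)
  have hS' : |S - t| ≤ ε ^ α := hS.trans hεα
  calc Real.exp 1 * (Real.exp N * tmsDist x Y) +
        (2 * ((N + 1) * (H * (Real.exp N * tmsDist x Y) ^ α)) + b * |S - t|) / a
      ≤ Real.exp 1 * (Real.exp N * Real.exp 3 * ε ^ α) +
        (2 * ((N + 1) * (H * ((Real.exp N * Real.exp 3) ^ α * ε ^ α))) + b * ε ^ α) / a := by
        gcongr Real.exp 1 * ?_ + (2 * ((N + 1) * (H * ?_)) + b * ?_) / a
    _ = _ := by ring

end HolderFlow

/-- Hölder continuity of the time-`τ` maps of the topological Markov flow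
with respect to the Bowen–Walters distance, uniformly for `|τ| < 1`. -/
theorem stmt17 (V : Type) (E : V → V → Prop)
    (hin : ∀ v, ∃ u, E u v) (hout : ∀ v, ∃ w, E v w)
    (r : TMS V E → ℝ) (a b H α : ℝ) (ha : 0 < a) (hab : ∀ x, a ≤ r x ∧ r x ≤ b)
    (hH : 0 < H) (hα : 0 < α) (hα1 : α ≤ 1)
    (hHol : ∀ x y : TMS V E, |r x - r y| ≤ H * tmsDist x y ^ α) :
    ∃ C₃ κ : ℝ, 0 < C₃ ∧ 0 < κ ∧ κ < 1 ∧
      ∀ (z w : SigmaR V E r) (τ : ℝ), |τ| < 1 →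
        dr r (flowR r τ z) (flowR r τ w) ≤ C₃ * dr r z w ^ κ := by
  rcases isEmpty_or_nonempty (TMS V E) with hemp | ⟨⟨x₀⟩⟩
  · exact ⟨1, 1 / 2, one_pos, by norm_num, by norm_num, fun z => (hemp.false z.1.1).elim⟩
  have hb : 0 < b := ha.trans_le ((hab x₀).1.trans (hab x₀).2)
  obtain ⟨C, hC, hbound⟩ := exists_holder_bound_of_dr_lt ha hb hab hH hα hα1 hHol
  refine ⟨C + (Real.exp 1 + 1), α / 2, by positivity, by positivity, by linarith, ?_⟩
  intro z w τ hτ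
  have hD0 : 0 ≤ dr r z w := d1_nonneg _ _
  rcases lt_or_ge (dr r z w) 1 with hD | hD
  · have hcont : ContinuousAt (fun ε : ℝ => C * ε ^ (α / 2)) (dr r z w) :=
      (Real.continuousAt_rpow_const _ _ (Or.inr (by positivity))).const_mul C
    have hle : dr r (flowR r τ z) (flowR r τ w) ≤ C * dr r z w ^ (α / 2) := by
      refine ge_of_tendsto (hcont.tendsto.mono_left (nhdsWithin_le_nhds (s := Set.Ioi (dr r z w)))) ?_
      filter_upwards [Ioo_mem_nhdsGT hD] with ε hε
      have hε0 : 0 < ε := hD0.trans_lt hε.1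
      refine (hbound z w τ ε hτ hε0 hε.2.le hε.1).trans ?_
      exact mul_le_mul_of_nonneg_left
        (Real.rpow_le_rpow_of_exponent_ge hε0 hε.2.le (by linarith)) hC
    refine hle.trans (mul_le_mul_of_nonneg_right ?_ (Real.rpow_nonneg hD0 _))
    linarith [Real.exp_pos 1]
  · have h1 : dr r (flowR r τ z) (flowR r τ w) ≤ Real.exp 1 + 1 := d1_le_const _ _
    have h2 : 1 ≤ dr r z w ^ (α / 2) := Real.one_le_rpow hD (by positivity)
    nlinarith [Real.exp_pos 1]
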